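/- arXiv:1809.01516 — 3 statements merged into one kernel-verified Lean document; each statement's English description precedes it below -/
import Mathlib

section
/- Let R be a unital algebra over ℂ, N ≥ 1, E_1, …, E_N ∈ R pairwise commuting elements, and a_0, …, a_N ∈ ℂ. For 0 ≤ l ≤ k ≤ N put Q_{k,l} = E_k ⋯ E_{l+1} (Q_{k,k} = 1) and P_k = Q_{k,0}, and suppose B = 1 + Σ_{l=0}^{N} a_l P_l is a unit in R. Let S = S₁ + 𝟙 aᵀ, where S₁ is the unit lower bidiagonal matrix with subdiagonal entries −E_p and 𝟙 aᵀ is the matrix whose only nonzero row is row 0 with entries a_l·1. Then the entries of S⁻¹ are given explicitly by: (S⁻¹)_{k,l} = B⁻¹ Q_{k,l} (1 + Σ_{j=0}^{l−1} a_j P_j) for 0 ≤ l ≤ k ≤ N, and (S⁻¹)_{k,l} = −B⁻¹ P_k Σ_{j=l}^{N} a_j Q_{j,l} for 0 ≤ k < l ≤ N. -/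
/-- The ordered product `E k * E (k - 1) * ⋯ * E (l + 1)`, equal to `1` when `k ≤ l`. -/
def descProd {R : Type*} [Monoid R] (E : ℕ → R) (k l : ℕ) : R :=
  ((List.range (k - l)).map (fun j => E (k - j))).prod

section DescProd

variable {R : Type*} [Monoid R] (E : ℕ → R)

theorem descProd_self (k : ℕ) : descProd E k k = 1 := by simp [descProd]

theorem descProd_succ {k l : ℕ} (h : l ≤ k) :
    descProd E (k + 1) l = E (k + 1) * descProd E k l := by
  have h1 : k + 1 - l = (k - l) + 1 := by omega
  simp only [descProd, h1, List.range_succ_eq_map, List.map_cons, List.prod_cons, List.map_map]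
  congr 3
  funext j
  simp

theorem descProd_mul_descProd {k l m : ℕ} (hml : m ≤ l) (hlk : l ≤ k) :
    descProd E k l * descProd E l m = descProd E k m := by
  induction k, hlk using Nat.le_induction with
  | base => rw [descProd_self, one_mul]
  | succ k hk ih => rw [descProd_succ E hk, descProd_succ E (hml.trans hk), mul_assoc, ih]

theorem commute_descProd_right {x : R} (h : ∀ p, Commute x (E p)) (k l : ℕ) :
    Commute x (descProd E k l) := by
  refine Commute.list_prod_right _ _ fun y hy => ?_
  obtain ⟨j, -, rfl⟩ := List.mem_map.mp hy
  exact h _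

variable {E}

theorem commute_descProd_descProd (hE : ∀ p q, Commute (E p) (E q)) (k l m n : ℕ) :
    Commute (descProd E k l) (descProd E m n) :=
  commute_descProd_right E (fun p => (commute_descProd_right E (hE p) k l).symm) m n

end DescProd

/-- Solution of the recurrence `x (k + 1) = E (k + 1) * x k + δ_{k + 1, l}` in terms of `x 0`. -/
theorem eq_descProd_mul_add_of_recurrence {R : Type*} [Ring R] {E x : ℕ → R} {N l : ℕ}
    (hx : ∀ k < N, x (k + 1) = E (k + 1) * x k + if k + 1 = l then 1 else 0) :
    ∀ k ≤ N, x k = descProd E k 0 * (x 0 - if l = 0 then 1 else 0)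
      + if l ≤ k then descProd E k l else 0 := by
  intro k
  induction k with
  | zero =>
    intro _
    rcases Nat.eq_zero_or_pos l with rfl | hl
    · simp [descProd_self]
    · simp [descProd_self, hl.ne']
  | succ k ih =>
    intro hk
    rw [hx k hk, ih (by omega), descProd_succ E (Nat.zero_le k), mul_add, mul_assoc, add_assoc]
    congr 1
    rcases lt_trichotomy l (k + 1) with h | rfl | h
    · rw [if_pos (by omega), if_neg (by omega), if_pos (by omega), add_zero,
        descProd_succ E (by omega)]
    · simp [descProd_self]
    · rw [if_neg (by omega), if_neg (by omega), if_neg (by omega), mul_zero, add_zero]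

theorem sum_range_ite_le_eq_sum_Icc {M : Type*} [AddCommMonoid M] (f : ℕ → M) (l N : ℕ) :
    ∑ q ∈ Finset.range (N + 1), (if l ≤ q then f q else 0) = ∑ q ∈ Finset.Icc l N, f q := by
  rw [← Finset.sum_filter]
  refine Finset.sum_congr ?_ fun _ _ => rfl
  ext q
  simp only [Finset.mem_filter, Finset.mem_range, Finset.mem_Icc]
  omega


/-- explicit entrywise formula for `S⁻¹`, used in Lemma 2 of the paper.
With pairwise commuting `E p`, ordered products `Q k l = E k ⋯ E (l+1)`, `P k = Q k 0`,
`S = S₁ + 𝟙 aᵀ` and `B = 1 + Σ_{l=0}^{N} a_l P_l` a unit, the entries of `S⁻¹` are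
`(S⁻¹)_{k,l} = B⁻¹ Q_{k,l} (1 + Σ_{j<l} a_j P_j)` for `l ≤ k` and
`(S⁻¹)_{k,l} = −B⁻¹ P_k Σ_{j=l}^{N} a_j Q_{j,l}` for `k < l`. -/
theorem stmt_2 (R : Type*) [Ring R] [Algebra ℂ R] (N : ℕ) (hN : 1 ≤ N)
    (E : ℕ → R) (hE : ∀ p q : ℕ, Commute (E p) (E q)) (a : ℕ → ℂ)
    (Q : ℕ → ℕ → R)
    (hQ : ∀ k l : ℕ, Q k l = ((List.range (k - l)).map (fun j => E (k - j))).prod)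
    (S : Matrix (Fin (N + 1)) (Fin (N + 1)) R)
    (hS : ∀ p q : Fin (N + 1),
      S p q = (if p = q then 1 else if (q : ℕ) + 1 = (p : ℕ) then -E (p : ℕ) else 0)
        + (if (p : ℕ) = 0 then a (q : ℕ) • (1 : R) else 0))
    (B Binv : R)
    (hB : B = 1 + ∑ l ∈ Finset.range (N + 1), a l • Q l 0)
    (hB1 : B * Binv = 1) (hB2 : Binv * B = 1)
    (Sinv : Matrix (Fin (N + 1)) (Fin (N + 1)) R)
    (hSinv1 : S * Sinv = 1) (hSinv2 : Sinv * S = 1) :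
    ∀ k l : Fin (N + 1),
      ((l : ℕ) ≤ (k : ℕ) →
        Sinv k l = Binv * Q (k : ℕ) (l : ℕ)
          * (1 + ∑ j ∈ Finset.range (l : ℕ), a j • Q j 0)) ∧
      ((k : ℕ) < (l : ℕ) →
        Sinv k l = -(Binv * Q (k : ℕ) 0
          * ∑ j ∈ Finset.Icc (l : ℕ) N, a j • Q j (l : ℕ))) := by
  obtain rfl : Q = descProd E := by
    funext k l
    exact hQ k l
  intro k l
  obtain ⟨x, hx⟩ : ∃ x : ℕ → R, ∀ q : Fin (N + 1), x q = Sinv q l :=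
    ⟨fun q => if h : q < N + 1 then Sinv ⟨q, h⟩ l else 0, fun q => dif_pos q.isLt⟩
  have hrow (p : Fin (N + 1)) : ∑ q, S p q * x q = if p = l then 1 else 0 := by
    simp only [hx, ← Matrix.mul_apply, hSinv1, Matrix.one_apply]
  have hrec : ∀ p < N, x (p + 1) = E (p + 1) * x p + if p + 1 = (l : ℕ) then 1 else 0 := by
    intro p hp
    have h := hrow ⟨p + 1, by omega⟩
    have hsplit (q : Fin (N + 1)) : S ⟨p + 1, by omega⟩ q * x q =
        (if q = ⟨p + 1, by omega⟩ then x (p + 1) else 0)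
          + (if q = ⟨p, by omega⟩ then -(E (p + 1) * x p) else 0) := by
      obtain ⟨q, hq⟩ := q
      rw [hS]
      simp only [Fin.mk.injEq]
      by_cases h1 : q = p + 1
      · subst h1; simp
      · by_cases h2 : q = p
        · subst h2; simp
        · simp [h1, h2, Ne.symm h1]
    simp only [hsplit, Finset.sum_add_distrib, Finset.sum_ite_eq', Finset.mem_univ, if_true] at h
    simp only [Fin.ext_iff] at h
    rw [← h]
    abel
  have hsol := eq_descProd_mul_add_of_recurrence hrec
  set y := x 0 - if (l : ℕ) = 0 then 1 else 0 with hy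
  set T := ∑ j ∈ Finset.Icc (l : ℕ) N, a j • descProd E j l with hT
  have hfirst : x 0 + ∑ q ∈ Finset.range (N + 1), a q • x q
      = if (l : ℕ) = 0 then 1 else 0 := by
    have h := hrow 0
    have hsplit (q : Fin (N + 1)) : S 0 q * x q =
        (if q = 0 then x 0 else 0) + a q • x q := by
      rw [hS]
      by_cases h1 : q = 0
      · subst h1; simp [add_mul]
      · simp [h1, Ne.symm h1]
    simp only [hsplit, Finset.sum_add_distrib, Finset.sum_ite_eq', Finset.mem_univ, if_true] at h
    rw [Fin.sum_univ_eq_sum_range (fun q => a q • x q)] at h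
    rw [h]
    simp only [Fin.ext_iff, Fin.val_zero, eq_comm]
  have hsum : ∑ q ∈ Finset.range (N + 1), a q • x q
      = (∑ q ∈ Finset.range (N + 1), a q • descProd E q 0) * y + T := by
    rw [hT, ← sum_range_ite_le_eq_sum_Icc, Finset.sum_mul, ← Finset.sum_add_distrib]
    refine Finset.sum_congr rfl fun q hq => ?_
    rw [hsol q (by simpa [Nat.lt_succ_iff] using hq), smul_add, smul_mul_assoc, smul_ite,
      smul_zero]
  have hBy : B * y = -T := by
    rw [hB, add_mul, one_mul]
    rw [hsum] at hfirst
    rw [← hfirst] at hy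
    rw [eq_neg_iff_add_eq_zero, add_assoc]
    nth_rewrite 1 [hy]
    abel
  have hyT : y = -(Binv * T) := by
    rw [← mul_neg, ← hBy, ← mul_assoc, hB2, one_mul]
  have hcommB (i j : ℕ) : Commute (descProd E i j) B := by
    rw [hB]
    exact (Commute.one_right _).add_right <| Commute.sum_right _ _ _ fun q _ =>
      (commute_descProd_descProd hE i j q 0).smul_right (a q)
  have hcomm (i j : ℕ) : Commute (descProd E i j) Binv :=
    Commute.units_inv_right (u := ⟨B, Binv, hB1, hB2⟩) (hcommB i j)
  have hk := hsol k (by omega)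
  have hPy : descProd E k 0 * y = -(Binv * descProd E k 0 * T) := by
    rw [hyT, mul_neg, ← mul_assoc, (hcomm k 0).eq]
  rw [hPy, hx] at hk
  refine ⟨fun hlk => ?_, fun hkl => ?_⟩
  · have hPT : descProd E k 0 * T
        = descProd E k l * ∑ j ∈ Finset.Icc (l : ℕ) N, a j • descProd E j 0 := by
      rw [hT, Finset.mul_sum, Finset.mul_sum]
      refine Finset.sum_congr rfl fun j hj => ?_
      rw [mul_smul_comm, mul_smul_comm, ← descProd_mul_descProd E (Nat.zero_le l) hlk, mul_assoc,
        (commute_descProd_descProd hE l 0 j l).eq,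
        descProd_mul_descProd E (Nat.zero_le l) (Finset.mem_Icc.mp hj).1]
    have hBsplit : B = (1 + ∑ j ∈ Finset.range (l : ℕ), a j • descProd E j 0)
        + ∑ j ∈ Finset.Icc (l : ℕ) N, a j • descProd E j 0 := by
      rw [hB, add_assoc, ← Finset.sum_range_add_sum_Ico _ l.isLt.le]
      rfl
    rw [hk, if_pos hlk, mul_assoc, hPT, mul_assoc, eq_sub_of_add_eq hBsplit.symm, mul_sub,
      mul_sub, (hcommB k l).eq, ← mul_assoc Binv B, hB2, one_mul]
    abel
  · rw [hk, if_neg (by omega), add_zero]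
end

section
/- Let X be a Banach space, R the algebra of bounded linear operators on X, N ≥ 1, E_1, …, E_N ∈ R, a_0, …, a_N ∈ ℂ, and define Q_{k,l}, P_k, S₁, S = S₁ + 𝟙 aᵀ and B = I + Σ_{l=0}^{N} a_l P_l as before, with B invertible in R. Let Ψ₀ ∈ X and let F be the column vector (Ψ₀, 0, …, 0)ᵀ ∈ X^{N+1}. Then the k-th component of S⁻¹F is (S⁻¹F)_k = P_k (B⁻¹ Ψ₀) for every 0 ≤ k ≤ N; that is, S⁻¹F = (B⁻¹Ψ₀, E_1 B⁻¹Ψ₀, E_2 E_1 B⁻¹Ψ₀, …, E_N ⋯ E_1 B⁻¹Ψ₀)ᵀ. -/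
/-- If `w` satisfies the two-term recursion `w (k + 1) = E (k + 1) * w k` and
`w 0 + ∑ a_l • w l = 1`, then the matrix `S₁ + 𝟙 aᵀ` sends `w` to the first basis vector. -/
theorem mulVec_eq_single_of_recursion {R : Type*} [Ring R] [Algebra ℂ R] (N : ℕ)
    (E : ℕ → R) (a : ℕ → ℂ) (w : ℕ → R) (hw : ∀ k, w (k + 1) = E (k + 1) * w k)
    (h0 : w 0 + ∑ l ∈ Finset.range (N + 1), a l • w l = 1)
    (S : Matrix (Fin (N + 1)) (Fin (N + 1)) R)
    (hS : ∀ p q : Fin (N + 1),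
      S p q = (if p = q then 1 else if (q : ℕ) + 1 = (p : ℕ) then -E (p : ℕ) else 0)
        + (if (p : ℕ) = 0 then a (q : ℕ) • (1 : R) else 0)) :
    S.mulVec (fun q => w q) = Pi.single 0 1 := by
  funext p
  simp only [Matrix.mulVec, dotProduct, hS]
  induction p using Fin.cases with
  | zero =>
    simpa [add_mul, Finset.sum_add_distrib, ite_mul, Finset.sum_range] using h0
  | succ p =>
    have hsplit : ∀ q : Fin (N + 1),
        ((if p.succ = q then 1 else if (q : ℕ) + 1 = (p.succ : ℕ) then -E (p.succ : ℕ) else 0)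
          + (if (p.succ : ℕ) = 0 then a (q : ℕ) • (1 : R) else 0)) * w q
        = (if p.succ = q then w q else 0)
          + (if p.castSucc = q then -E (p + 1) * w q else 0) := by
      intro q
      by_cases h1 : p.succ = q
      · subst h1
        simp [Fin.ext_iff]
      · by_cases h2 : p.castSucc = q
        · subst h2
          simp [Fin.ext_iff]
        · have h3 : ¬ (q : ℕ) = (p : ℕ) := fun h => h2 (Fin.ext h.symm)
          simp [h1, h2, h3]
    simp_rw [hsplit, Finset.sum_add_distrib, Finset.sum_ite_eq]
    simp [hw]

/-- For `R = L(X)` the bounded operators on a Banach space `X`,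
`S = S₁ + 𝟙 aᵀ`, `B = I + Σ_{l=0}^{N} a_l P_l` invertible, and
`F = (Ψ₀, 0, …, 0)ᵀ ∈ X^{N+1}`, the `k`-th component of `S⁻¹F` equals
`P_k (B⁻¹ Ψ₀) = E_k ⋯ E_1 (B⁻¹ Ψ₀)`. -/
theorem stmt_3 (X : Type*) [NormedAddCommGroup X] [NormedSpace ℂ X] [CompleteSpace X]
    (N : ℕ) (hN : 1 ≤ N)
    (E : ℕ → (X →L[ℂ] X)) (a : ℕ → ℂ)
    (Q : ℕ → ℕ → (X →L[ℂ] X))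
    (hQ : ∀ k l : ℕ, Q k l = ((List.range (k - l)).map (fun j => E (k - j))).prod)
    (S : Matrix (Fin (N + 1)) (Fin (N + 1)) (X →L[ℂ] X))
    (hS : ∀ p q : Fin (N + 1),
      S p q = (if p = q then 1 else if (q : ℕ) + 1 = (p : ℕ) then -E (p : ℕ) else 0)
        + (if (p : ℕ) = 0 then a (q : ℕ) • (1 : X →L[ℂ] X) else 0))
    (B Binv : X →L[ℂ] X)
    (hB : B = 1 + ∑ l ∈ Finset.range (N + 1), a l • Q l 0)
    (hB1 : B * Binv = 1) (hB2 : Binv * B = 1)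
    (Sinv : Matrix (Fin (N + 1)) (Fin (N + 1)) (X →L[ℂ] X))
    (hSinv1 : S * Sinv = 1) (hSinv2 : Sinv * S = 1)
    (Ψ₀ : X) (F : Fin (N + 1) → X)
    (hF : ∀ l : Fin (N + 1), F l = if (l : ℕ) = 0 then Ψ₀ else 0) :
    ∀ k : Fin (N + 1), (∑ l : Fin (N + 1), Sinv k l (F l)) = Q (k : ℕ) 0 (Binv Ψ₀) := by
  have hQ0 : Q 0 0 = 1 := by simp [hQ]
  have hQs : ∀ k, Q (k + 1) 0 = E (k + 1) * Q k 0 := by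
    intro k
    simp [hQ, List.range_succ_eq_map, Function.comp_def]
  have hSw : S.mulVec (fun q => Q q 0 * Binv) = Pi.single 0 1 := by
    refine mulVec_eq_single_of_recursion N E a (fun q => Q q 0 * Binv) ?_ ?_ S hS
    · intro k
      simp only [hQs, mul_assoc]
    · rw [← hB1, hB, hQ0, add_mul, Finset.sum_mul]
      simp only [smul_mul_assoc]
  have hcol : (fun q : Fin (N + 1) => Q q 0 * Binv) = Sinv.mulVec (Pi.single 0 1) := by
    rw [← hSw, Matrix.mulVec_mulVec, hSinv2, Matrix.one_mulVec]
  intro k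
  have hk : Q k 0 * Binv = Sinv k 0 := by
    simpa using congrFun hcol k
  have hsum : ∑ l : Fin (N + 1), Sinv k l (F l) = Sinv k 0 Ψ₀ := by
    simp [Fin.sum_univ_succ, hF]
  rw [hsum, ← hk, mul_apply_eq_comp]
end

section
/- Let X be a complex Banach space and a < b real numbers. Let U : [0, b − a] → L(X) be a continuous map into the bounded linear operators on X with ‖U(s)‖ ≤ M_U for all s ∈ [0, b − a], let V : [a, b] → L(X) be Lipschitz continuous with constant K (i.e. ‖V(t) − V(s)‖ ≤ K|t − s|) and satisfy ‖V(t)‖ ≤ M for all t ∈ [a, b], and let g : [a, b] → ℝ be Lipschitz continuous with constant K_g and vanish at one of the endpoints, i.e. g(θ) = 0 for some θ ∈ {a, b}. Then ‖∫_a^b U(b − t) ∘ V(t) · g(t) dt‖ ≤ M_U ( K (b − a) ∫_a^b |g(t)| dt + M K_g (b − a)²/2 ). -/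
/-- The distance to an endpoint of `[a, b]` has integral `(b - a) ^ 2 / 2` over `[a, b]`. -/
theorem integral_abs_sub_endpoint {a b θ : ℝ} (hab : a ≤ b) (hθ : θ = a ∨ θ = b) :
    ∫ t in a..b, |t - θ| = (b - a) ^ 2 / 2 := by
  rcases hθ with rfl | rfl
  · have h : ∫ t in θ..b, |t - θ| = ∫ t in θ..b, (t - θ) := by
      refine intervalIntegral.integral_congr fun t ht => ?_
      rw [Set.uIcc_of_le hab] at ht
      exact abs_of_nonneg (sub_nonneg.2 ht.1)
    rw [h, intervalIntegral.integral_comp_sub_right (fun x => x), integral_id]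
    ring
  · have h : ∫ t in a..θ, |t - θ| = ∫ t in a..θ, (θ - t) := by
      refine intervalIntegral.integral_congr fun t ht => ?_
      rw [Set.uIcc_of_le hab] at ht
      exact (abs_of_nonpos (sub_nonpos.2 ht.2)).trans (neg_sub _ _)
    rw [h, intervalIntegral.integral_comp_sub_left (fun x => x), integral_id]
    ring

/-- the key integral estimate in the proof of Lemma 2.
For a bounded continuous operator family `U` on `[0, b−a]`, a Lipschitz bounded
operator-valued potential `V` on `[a, b]` and a Lipschitz scalar function `g` vanishing
at one endpoint of `[a, b]`,
`‖∫_a^b U(b−t) ∘ V(t) · g(t) dt‖ ≤ M_U (K (b−a) ∫_a^b |g| + M K_g (b−a)²/2)`. -/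
theorem stmt_8 (X : Type*) [NormedAddCommGroup X] [NormedSpace ℂ X] [CompleteSpace X]
    (a b : ℝ) (hab : a < b)
    (U V : ℝ → (X →L[ℂ] X)) (g : ℝ → ℝ)
    (M_U M K K_g : ℝ)
    (hUcont : ContinuousOn U (Set.Icc 0 (b - a)))
    (hUbound : ∀ s ∈ Set.Icc 0 (b - a), ‖U s‖ ≤ M_U)
    (hVlip : ∀ t ∈ Set.Icc a b, ∀ s ∈ Set.Icc a b, ‖V t - V s‖ ≤ K * |t - s|)
    (hVbound : ∀ t ∈ Set.Icc a b, ‖V t‖ ≤ M)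
    (hglip : ∀ t ∈ Set.Icc a b, ∀ s ∈ Set.Icc a b, |g t - g s| ≤ K_g * |t - s|)
    (θ : ℝ) (hθ : θ = a ∨ θ = b) (hgθ : g θ = 0) :
    ‖∫ t in a..b, g t • ((U (b - t)).comp (V t))‖ ≤
      M_U * (K * (b - a) * (∫ t in a..b, |g t|) + M * K_g * (b - a) ^ 2 / 2) := by
  have ha : a ∈ Set.Icc a b := Set.left_mem_Icc.2 hab.le
  have hb : b ∈ Set.Icc a b := Set.right_mem_Icc.2 hab.le
  have hθmem : θ ∈ Set.Icc a b := by rcases hθ with rfl | rfl <;> assumption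
  have hMU : 0 ≤ M_U :=
    (norm_nonneg _).trans (hUbound 0 ⟨le_rfl, sub_nonneg.2 hab.le⟩)
  have hK : 0 ≤ K * (b - a) := by
    have h := (norm_nonneg _).trans (hVlip b hb a ha)
    rwa [abs_of_pos (sub_pos.2 hab)] at h
  have hpointwise : ∀ t ∈ Set.Icc a b,
      ‖g t • ((U (b - t)).comp (V t))‖ ≤ M_U * M * K_g * |t - θ| := by
    intro t ht
    have hg : |g t| ≤ K_g * |t - θ| := by simpa [hgθ] using hglip t ht θ hθmem
    have hU : ‖U (b - t)‖ ≤ M_U :=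
      hUbound _ ⟨sub_nonneg.2 ht.2, sub_le_sub_left ht.1 b⟩
    have hUV : ‖(U (b - t)).comp (V t)‖ ≤ M_U * M :=
      (ContinuousLinearMap.opNorm_comp_le _ _).trans
        (mul_le_mul hU (hVbound t ht) (norm_nonneg _) hMU)
    calc ‖g t • ((U (b - t)).comp (V t))‖
        = |g t| * ‖(U (b - t)).comp (V t)‖ := by rw [norm_smul, Real.norm_eq_abs]
      _ ≤ (K_g * |t - θ|) * (M_U * M) :=
          mul_le_mul hg hUV (norm_nonneg _) ((abs_nonneg _).trans hg)
      _ = M_U * M * K_g * |t - θ| := by ring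
  have hmain : ‖∫ t in a..b, g t • ((U (b - t)).comp (V t))‖ ≤
      M_U * M * K_g * ((b - a) ^ 2 / 2) := by
    rw [← integral_abs_sub_endpoint hab.le hθ, ← intervalIntegral.integral_const_mul]
    refine intervalIntegral.norm_integral_le_of_norm_le hab.le
      (Filter.Eventually.of_forall fun t ht => hpointwise t (Set.Ioc_subset_Icc_self ht)) ?_
    exact Continuous.intervalIntegrable (by fun_prop) _ _
  have hg_int : 0 ≤ ∫ t in a..b, |g t| :=
    intervalIntegral.integral_nonneg hab.le fun _ _ => abs_nonneg _
  have := mul_nonneg hMU (mul_nonneg hK hg_int)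
  linarith
end
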